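/- arXiv:2601.17337 — 3 statements merged into one kernel-verified Lean document; each statement's English description precedes it below -/
import Mathlib

section
/- For d ≥ 3 and R > 1, the average of |s - R e₁|^{-d} over the unit sphere S^{d-1} in ℝ^d equals 1/(R^{d-2}(R²-1)); that is, (1/|S^{d-1}|) ∫_{S^{d-1}} |s - R e₁|^{-d} dσ(s) = R^{2-d}/(R²-1). -/
open MeasureTheory Real

section HausdorffSphere

variable {E : Type*} [NormedAddCommGroup E] [InnerProductSpace ℝ E]

lemma sph_norm_graph (p : E) (hp : ‖p‖ = 1) (w : E) (hw : inner ℝ p w = 0) (c : ℝ) :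
    ‖w + c • p‖ ^ 2 = ‖w‖ ^ 2 + c ^ 2 := by
  rw [norm_add_sq_real, inner_smul_right, real_inner_comm, hw, norm_smul, hp]
  simp

lemma sph_decomp (p : E) (hp : ‖p‖ = 1) (s : E) :
    ((ℝ ∙ p)ᗮ.orthogonalProjectionOnto s : E) + (inner ℝ p s) • p = s := by
  have h := Submodule.starProjection_add_starProjection_orthogonal (K := ℝ ∙ p) s
  rw [Submodule.starProjection_unit_singleton ℝ hp] at h
  rw [add_comm]
  exact h

variable [MeasurableSpace E] [BorelSpace E]

lemma sph_finite [FiniteDimensional ℝ E] (n : ℕ) (hn : Module.finrank ℝ E = n + 1) :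
    μH[(n : ℝ)] (Metric.sphere (0 : E) 1) < ⊤ := by
  have : Fact (Module.finrank ℝ E = n + 1) := ⟨hn⟩
  apply (isCompact_sphere (0 : E) 1).measure_lt_top_of_nhdsWithin
  intro p hp
  have hp1 : ‖p‖ = 1 := by simpa using hp
  have hp0 : p ≠ 0 := by rintro rfl; simp at hp1
  have hV : Module.finrank ℝ (ℝ ∙ p)ᗮ = n := Submodule.finrank_orthogonal_span_singleton hp0
  have hH : (μH[(n : ℝ)] : Measure (ℝ ∙ p)ᗮ).IsAddHaarMeasure := by
    have := MeasureTheory.isAddHaarMeasure_hausdorffMeasure (E := (ℝ ∙ p)ᗮ)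
    rwa [hV] at this
  let f : (ℝ ∙ p)ᗮ → E := fun w => (w : E) + √(1 - ‖w‖ ^ 2) • p
  have hf : ContDiffAt ℝ 1 f 0 := by
    have h1 : ContDiffAt ℝ 1 (fun w : (ℝ ∙ p)ᗮ => (w : E)) 0 :=
      ((ℝ ∙ p)ᗮ.subtypeL).contDiff.contDiffAt
    have h2 : ContDiffAt ℝ 1 (fun w : (ℝ ∙ p)ᗮ => √(1 - ‖w‖ ^ 2)) 0 := by
      apply ContDiffAt.sqrt
      · exact (contDiff_const.sub (contDiff_norm_sq ℝ)).contDiffAt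
      · simp
    exact h1.add (h2.smul contDiffAt_const)
  obtain ⟨K, t, ht, hK⟩ := hf.exists_lipschitzOnWith
  let P := (ℝ ∙ p)ᗮ.orthogonalProjectionOnto
  have hP0 : P p = 0 := by
    have := sph_decomp p hp1 p
    rw [real_inner_self_eq_norm_sq, hp1] at this
    apply Subtype.ext
    rw [one_pow, one_smul] at this
    exact add_eq_right.1 this
  have hPc : Filter.Tendsto P (nhds p) (nhds 0) := by
    have := P.continuous.tendsto p
    rwa [hP0] at this
  have hin : ∀ᶠ s in nhds p, 0 < inner ℝ p s := by
    have hc : Continuous (fun s : E => inner ℝ p s) := by fun_prop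
    apply hc.tendsto p |>.eventually_const_lt
    rw [real_inner_self_eq_norm_sq, hp1]; norm_num
  have hB : Metric.closedBall (0 : (ℝ ∙ p)ᗮ) 1 ∈ nhds (0 : (ℝ ∙ p)ᗮ) :=
    Metric.closedBall_mem_nhds _ one_pos
  refine ⟨f '' (t ∩ Metric.closedBall 0 1), ?_, ?_⟩
  · rw [mem_nhdsWithin_iff_eventually]
    filter_upwards [hPc.eventually (Filter.inter_mem ht hB), hin] with s hs hps hsS
    refine ⟨P s, hs, ?_⟩
    have hd := sph_decomp p hp1 s
    have hs1 : ‖s‖ = 1 := by simpa using hsS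
    have hn := sph_norm_graph p hp1 (P s : E)
      (Submodule.mem_orthogonal_singleton_iff_inner_right.1 (P s).2) (inner ℝ p s)
    change ((P s : E)) + _ = s at hd
    rw [hd, hs1] at hn
    change (P s : E) + √(1 - ‖P s‖ ^ 2) • p = s
    have : √(1 - ‖P s‖ ^ 2) = inner ℝ p s := by
      rw [← Submodule.norm_coe, show 1 - ‖(P s : E)‖ ^ 2 = (inner ℝ p s) ^ 2 by linarith,
        Real.sqrt_sq hps.le]
    rw [this, hd]
  · refine lt_of_le_of_lt ((hK.mono Set.inter_subset_left).hausdorffMeasure_image_le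
      (Nat.cast_nonneg n)) ?_
    apply ENNReal.mul_lt_top
    · exact ENNReal.rpow_lt_top_of_nonneg (Nat.cast_nonneg n) ENNReal.coe_ne_top
    · exact lt_of_le_of_lt (measure_mono Set.inter_subset_right)
        (isCompact_closedBall _ _).measure_lt_top

lemma sph_pos [FiniteDimensional ℝ E] (n : ℕ) (hn : Module.finrank ℝ E = n + 1) (p : E)
    (hp1 : ‖p‖ = 1) :
    0 < μH[(n : ℝ)] (Metric.sphere (0 : E) 1) := by
  have : Fact (Module.finrank ℝ E = n + 1) := ⟨hn⟩
  have hp0 : p ≠ 0 := by rintro rfl; simp at hp1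
  have hV : Module.finrank ℝ (ℝ ∙ p)ᗮ = n := Submodule.finrank_orthogonal_span_singleton hp0
  have hH : (μH[(n : ℝ)] : Measure (ℝ ∙ p)ᗮ).IsAddHaarMeasure := by
    have := MeasureTheory.isAddHaarMeasure_hausdorffMeasure (E := (ℝ ∙ p)ᗮ)
    rwa [hV] at this
  have h1 := ((ℝ ∙ p)ᗮ.lipschitzWith_orthogonalProjectionOnto).hausdorffMeasure_image_le
      (Nat.cast_nonneg n) (Metric.sphere (0 : E) 1)
  simp only [ENNReal.coe_one, ENNReal.one_rpow, one_mul] at h1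
  refine lt_of_lt_of_le ?_ h1
  refine lt_of_lt_of_le (Metric.measure_ball_pos μH[(n : ℝ)] (0 : (ℝ ∙ p)ᗮ) one_pos)
    (measure_mono ?_)
  intro w hw
  have hw1 : ‖(w : E)‖ < 1 := by simpa using hw
  have hpw : inner ℝ p (w : E) = 0 := Submodule.mem_orthogonal_singleton_iff_inner_right.1 w.2
  refine ⟨(w : E) + √(1 - ‖(w : E)‖ ^ 2) • p, ?_, ?_⟩
  · have := sph_norm_graph p hp1 w hpw (√(1 - ‖(w : E)‖ ^ 2))
    rw [Real.sq_sqrt (by nlinarith [norm_nonneg (w : E)])] at this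
    rw [mem_sphere_zero_iff_norm]
    have h2 : ‖(w : E) + √(1 - ‖(w : E)‖ ^ 2) • p‖ ^ 2 = 1 := by linarith
    exact (pow_eq_one_iff_of_nonneg (norm_nonneg _) two_ne_zero).1 h2
  · have := sph_decomp p hp1 ((w : E) + √(1 - ‖(w : E)‖ ^ 2) • p)
    rw [inner_add_right, hpw, inner_smul_right, real_inner_self_eq_norm_sq, hp1] at this
    apply Subtype.ext
    simpa using this

end HausdorffSphere

lemma sph_param_deriv {X : Type*} [TopologicalSpace X] [T2Space X] [MeasurableSpace X]
    [BorelSpace X] [SecondCountableTopology X]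
    (μ : Measure X) (S : Set X) (hS : IsCompact S) (hμ : μ S < ⊤) (f f' : ℝ → X → ℝ)
    (U : Set ℝ) (hU : IsOpen U) (x₀ : ℝ) (hx : x₀ ∈ U)
    (hf : ∀ x ∈ U, ∀ s ∈ S, HasDerivAt (fun y => f y s) (f' x s) x)
    (hc : ∀ x ∈ U, ContinuousOn (f x) S)
    (hc' : ContinuousOn (fun z : ℝ × X => f' z.1 z.2) (U ×ˢ S)) :
    HasDerivAt (fun x => ∫ s in S, f x s ∂μ) (∫ s in S, f' x₀ s ∂μ) x₀ := by
  obtain ⟨ε, hε, hball⟩ := Metric.nhds_basis_closedBall.mem_iff.1 (hU.mem_nhds hx)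
  have hcomp : IsCompact (Metric.closedBall x₀ ε ×ˢ S) := (isCompact_closedBall _ _).prod hS
  obtain ⟨C, hC⟩ := hcomp.exists_bound_of_continuousOn
    (hc'.mono (Set.prod_mono hball subset_rfl))
  have : IsFiniteMeasure (μ.restrict S) := ⟨by simpa using hμ⟩
  have hcx : ContinuousOn (f' x₀) S := by
    refine hc'.comp (f := fun s => (x₀, s)) (by fun_prop) ?_
    intro s hs; exact ⟨hx, hs⟩
  have hfi : IntegrableOn (f x₀) S μ := by
    obtain ⟨C, hC⟩ := hS.exists_bound_of_continuousOn (hc x₀ hx)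
    refine Integrable.of_bound ((hc x₀ hx).aestronglyMeasurable hS.measurableSet) C ?_
    exact (ae_restrict_iff' hS.measurableSet).2 (Filter.Eventually.of_forall hC)
  refine (hasDerivAt_integral_of_dominated_loc_of_deriv_le (bound := fun _ => C)
    (Metric.closedBall_mem_nhds x₀ hε) ?_ hfi
    (hcx.aestronglyMeasurable hS.measurableSet) ?_ (integrable_const C) ?_).2
  · filter_upwards [hU.mem_nhds hx] with x hx'
    exact (hc x hx').aestronglyMeasurable hS.measurableSet
  · refine (ae_restrict_iff' hS.measurableSet).2 (Filter.Eventually.of_forall ?_)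
    intro s hs x hx'
    exact hC (x, s) ⟨hx', hs⟩
  · refine (ae_restrict_iff' hS.measurableSet).2 (Filter.Eventually.of_forall ?_)
    intro s hs x hx'
    exact hf x (hball hx') s hs

/-- Rotation in the coordinate plane `(i, j)`, as a linear map. -/
noncomputable def sphRotLin {d : ℕ} (i j : Fin d) (θ : ℝ) :
    EuclideanSpace ℝ (Fin d) →ₗ[ℝ] EuclideanSpace ℝ (Fin d) where
  toFun x := x + EuclideanSpace.single i ((cos θ - 1) * x i - sin θ * x j)
    + EuclideanSpace.single j (sin θ * x i + (cos θ - 1) * x j)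
  map_add' x y := by
    ext k
    simp only [PiLp.add_apply, PiLp.single_apply]
    split_ifs <;> ring
  map_smul' c x := by
    ext k
    simp only [PiLp.add_apply, PiLp.single_apply, PiLp.smul_apply, smul_eq_mul, RingHom.id_apply]
    split_ifs <;> ring

lemma sphRotLin_apply {d : ℕ} (i j : Fin d) (θ : ℝ) (x : EuclideanSpace ℝ (Fin d)) :
    sphRotLin i j θ x = x + EuclideanSpace.single i ((cos θ - 1) * x i - sin θ * x j)
    + EuclideanSpace.single j (sin θ * x i + (cos θ - 1) * x j) := rfl

lemma sphRotLin_norm {d : ℕ} (i j : Fin d) (hij : i ≠ j) (θ : ℝ)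
    (x : EuclideanSpace ℝ (Fin d)) : ‖sphRotLin i j θ x‖ = ‖x‖ := by
  have h : ‖sphRotLin i j θ x‖ ^ 2 = ‖x‖ ^ 2 := by
    rw [sphRotLin_apply, norm_add_sq_real, norm_add_sq_real]
    simp only [EuclideanSpace.inner_single_right, PiLp.add_apply, PiLp.single_apply,
      PiLp.norm_single, Real.norm_eq_abs, sq_abs]
    simp [hij.symm]
    have := Real.sin_sq_add_cos_sq θ
    linear_combination (x i ^ 2 + x j ^ 2) * this
  exact (pow_left_inj₀ (norm_nonneg _) (norm_nonneg _) two_ne_zero).1 h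

/-- Rotation in the coordinate plane `(i, j)`. -/
noncomputable def sphRot {d : ℕ} (i j : Fin d) (hij : i ≠ j) (θ : ℝ) :
    EuclideanSpace ℝ (Fin d) ≃ₗᵢ[ℝ] EuclideanSpace ℝ (Fin d) :=
  LinearIsometry.toLinearIsometryEquiv ⟨sphRotLin i j θ, sphRotLin_norm i j hij θ⟩ rfl

lemma sphRot_i {d : ℕ} (i j : Fin d) (hij : i ≠ j) (θ : ℝ) (x : EuclideanSpace ℝ (Fin d)) :
    sphRot i j hij θ x i = cos θ * x i - sin θ * x j := by
  change sphRotLin i j θ x i = _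
  rw [sphRotLin_apply]
  simp [hij]
  ring

lemma sphRot_j {d : ℕ} (i j : Fin d) (hij : i ≠ j) (θ : ℝ) (x : EuclideanSpace ℝ (Fin d)) :
    sphRot i j hij θ x j = sin θ * x i + cos θ * x j := by
  change sphRotLin i j θ x j = _
  rw [sphRotLin_apply]
  simp [hij.symm]
  ring

lemma sphRot_integral {d : ℕ} (i j : Fin d) (hij : i ≠ j) (θ m : ℝ)
    (g : EuclideanSpace ℝ (Fin d) → ℝ) :
    ∫ s in Metric.sphere (0 : EuclideanSpace ℝ (Fin d)) 1, g (sphRot i j hij θ s) ∂μH[m]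
      = ∫ s in Metric.sphere (0 : EuclideanSpace ℝ (Fin d)) 1, g s ∂μH[m] := by
  have h := ((sphRot i j hij θ).toIsometryEquiv.measurePreserving_hausdorffMeasure m)
  have h2 := h.setIntegral_preimage_emb
    (sphRot i j hij θ).toIsometryEquiv.toHomeomorph.measurableEmbedding g
    (Metric.sphere (0 : EuclideanSpace ℝ (Fin d)) 1)
  have h3 : (sphRot i j hij θ).toIsometryEquiv ⁻¹'
      (Metric.sphere (0 : EuclideanSpace ℝ (Fin d)) 1) = Metric.sphere 0 1 := by
    ext x; simp
  rw [h3] at h2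
  exact h2

lemma sph_coord_mem {d : ℕ} {s : EuclideanSpace ℝ (Fin d)}
    (hs : s ∈ Metric.sphere (0 : EuclideanSpace ℝ (Fin d)) 1) (i : Fin d) :
    s i ∈ Set.Icc (-1 : ℝ) 1 := by
  have h1 : ‖s i‖ ≤ ‖s‖ := PiLp.norm_apply_le s i
  rw [mem_sphere_zero_iff_norm.1 hs] at h1
  exact abs_le.1 h1

lemma sph_integrable {d : ℕ} (m : ℝ)
    (hμ : μH[m] (Metric.sphere (0 : EuclideanSpace ℝ (Fin d)) 1) < ⊤)
    (g : EuclideanSpace ℝ (Fin d) → ℝ) (hg : ContinuousOn g (Metric.sphere 0 1)) :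
    IntegrableOn g (Metric.sphere (0 : EuclideanSpace ℝ (Fin d)) 1) μH[m] := by
  have hS := isCompact_sphere (0 : EuclideanSpace ℝ (Fin d)) 1
  have : IsFiniteMeasure (μH[m].restrict (Metric.sphere (0 : EuclideanSpace ℝ (Fin d)) 1)) :=
    ⟨by simpa using hμ⟩
  obtain ⟨C, hC⟩ := hS.exists_bound_of_continuousOn hg
  refine Integrable.of_bound (hg.aestronglyMeasurable hS.measurableSet) C ?_
  exact (ae_restrict_iff' hS.measurableSet).2 (Filter.Eventually.of_forall hC)

lemma sph_ibp {d : ℕ} (m : ℝ)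
    (hμ : μH[m] (Metric.sphere (0 : EuclideanSpace ℝ (Fin d)) 1) < ⊤)
    (i j : Fin d) (hij : i ≠ j) (h h' : ℝ → ℝ)
    (hh : ∀ t ∈ Set.Icc (-1 : ℝ) 1, HasDerivAt h (h' t) t)
    (hc : ContinuousOn h' (Set.Icc (-1) 1)) :
    ∫ s in Metric.sphere (0 : EuclideanSpace ℝ (Fin d)) 1,
      (s i * h (s i) - s j ^ 2 * h' (s i)) ∂μH[m] = 0 := by
  have hhc : ContinuousOn h (Set.Icc (-1) 1) := fun t ht => (hh t ht).continuousAt.continuousWithinAt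
  have hmem : ∀ θ : ℝ, ∀ s ∈ Metric.sphere (0 : EuclideanSpace ℝ (Fin d)) 1,
      cos θ * s i - sin θ * s j ∈ Set.Icc (-1 : ℝ) 1 := by
    intro θ s hs
    rw [← sphRot_i i j hij]
    apply sph_coord_mem
    simpa using hs
  have key := sph_param_deriv μH[m] (Metric.sphere (0 : EuclideanSpace ℝ (Fin d)) 1)
    (isCompact_sphere _ _) hμ
    (fun θ s => (sin θ * s i + cos θ * s j) * h (cos θ * s i - sin θ * s j))
    (fun θ s => (cos θ * s i - sin θ * s j) * h (cos θ * s i - sin θ * s j)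
      + (sin θ * s i + cos θ * s j) *
        (h' (cos θ * s i - sin θ * s j) * (-sin θ * s i - cos θ * s j)))
    Set.univ isOpen_univ 0 (Set.mem_univ _) ?_ ?_ ?_
  · have hconst : (fun θ : ℝ => ∫ s in Metric.sphere (0 : EuclideanSpace ℝ (Fin d)) 1,
        (sin θ * s i + cos θ * s j) * h (cos θ * s i - sin θ * s j) ∂μH[m])
        = fun _ => ∫ s in Metric.sphere (0 : EuclideanSpace ℝ (Fin d)) 1,
          s j * h (s i) ∂μH[m] := by
      funext θ
      rw [← sphRot_integral i j hij θ m (fun s => s j * h (s i))]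
      simp only [sphRot_i, sphRot_j]
    rw [hconst] at key
    have := key.unique (hasDerivAt_const _ _)
    refine Eq.trans ?_ this
    congr 1
    funext s
    simp only [cos_zero, sin_zero, one_mul, zero_mul, neg_zero, sub_zero, zero_add, zero_sub]
    ring
  · intro θ _ s hs
    have h1 : HasDerivAt (fun y => cos y * s i - sin y * s j) (-sin θ * s i - cos θ * s j) θ :=
      ((hasDerivAt_cos θ).mul_const _).sub ((hasDerivAt_sin θ).mul_const _)
    have h2 : HasDerivAt (fun y => sin y * s i + cos y * s j) (cos θ * s i - sin θ * s j) θ := by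
      exact (((hasDerivAt_sin θ).mul_const (s i)).add
        ((hasDerivAt_cos θ).mul_const (s j))).congr_deriv (by ring)
    exact h2.mul ((hh _ (hmem θ s hs)).comp θ h1)
  · intro θ _
    refine ContinuousOn.mul (by fun_prop) (hhc.comp (by fun_prop) (fun s hs => hmem θ s hs))
  · have e1 : ContinuousOn (fun z : ℝ × EuclideanSpace ℝ (Fin d) =>
        h (cos z.1 * z.2 i - sin z.1 * z.2 j)) (Set.univ ×ˢ Metric.sphere 0 1) :=
      hhc.comp (by fun_prop) (fun z hz => hmem z.1 z.2 hz.2)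
    have e2 : ContinuousOn (fun z : ℝ × EuclideanSpace ℝ (Fin d) =>
        h' (cos z.1 * z.2 i - sin z.1 * z.2 j)) (Set.univ ×ˢ Metric.sphere 0 1) :=
      hc.comp (by fun_prop) (fun z hz => hmem z.1 z.2 hz.2)
    exact (ContinuousOn.mul (Continuous.continuousOn (by fun_prop)) e1).add
      (ContinuousOn.mul (Continuous.continuousOn (by fun_prop))
        (e2.mul (Continuous.continuousOn (by fun_prop))))

lemma sph_zonal {n : ℕ} (m : ℝ)
    (hμ : μH[m] (Metric.sphere (0 : EuclideanSpace ℝ (Fin (n + 1))) 1) < ⊤)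
    (h h' : ℝ → ℝ)
    (hh : ∀ t ∈ Set.Icc (-1 : ℝ) 1, HasDerivAt h (h' t) t)
    (hc : ContinuousOn h' (Set.Icc (-1) 1)) :
    ∫ s in Metric.sphere (0 : EuclideanSpace ℝ (Fin (n + 1))) 1,
      ((1 - s 0 ^ 2) * h' (s 0) - n * s 0 * h (s 0)) ∂μH[m] = 0 := by
  have hhc : ContinuousOn h (Set.Icc (-1) 1) := fun t ht => (hh t ht).continuousAt.continuousWithinAt
  have e1 : ContinuousOn (fun z : EuclideanSpace ℝ (Fin (n + 1)) => h (z 0))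
      (Metric.sphere 0 1) := hhc.comp (by fun_prop) (fun z hz => sph_coord_mem hz 0)
  have e2 : ContinuousOn (fun z : EuclideanSpace ℝ (Fin (n + 1)) => h' (z 0))
      (Metric.sphere 0 1) := hc.comp (by fun_prop) (fun z hz => sph_coord_mem hz 0)
  have h1 : ∫ s in Metric.sphere (0 : EuclideanSpace ℝ (Fin (n + 1))) 1,
      (∑ j : Fin n, (s 0 * h (s 0) - s j.succ ^ 2 * h' (s 0))) ∂μH[m] = 0 := by
    rw [integral_finsetSum]
    · apply Finset.sum_eq_zero
      intro j _
      exact sph_ibp m hμ 0 j.succ (Fin.succ_ne_zero j).symm h h' hh hc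
    · intro j _
      apply sph_integrable m hμ
      exact (ContinuousOn.mul (Continuous.continuousOn (by fun_prop)) e1).sub
        (ContinuousOn.mul (Continuous.continuousOn (by fun_prop)) e2)
  rw [← neg_eq_zero, ← integral_neg, ← h1]
  apply setIntegral_congr_fun (isCompact_sphere _ _).measurableSet
  intro s hs
  have hs2 : ∑ j : Fin n, s j.succ ^ 2 = 1 - s 0 ^ 2 := by
    have := EuclideanSpace.real_norm_sq_eq s
    rw [mem_sphere_zero_iff_norm.1 hs, Fin.sum_univ_succ] at this
    linarith
  simp only [Finset.sum_sub_distrib, ← Finset.sum_mul, hs2, Finset.sum_const, Finset.card_univ,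
    Fintype.card_fin, nsmul_eq_mul]
  ring

lemma sph_aux_zero (c : ℝ) {I : ℝ} (h : I = 0) : 0 = c * I := by rw [h, mul_zero]

lemma sph_q_pos (r t : ℝ) (hr : r ∈ Set.Ioo (-1 : ℝ) 1) (ht : t ∈ Set.Icc (-1 : ℝ) 1) :
    0 < 1 + r ^ 2 - 2 * r * t := by
  obtain ⟨h1, h2⟩ := hr
  obtain ⟨h3, h4⟩ := ht
  rcases le_total 0 t with h | h
  · nlinarith [mul_nonneg h (sq_nonneg (1 - r)), mul_nonneg (sub_nonneg.2 h4) (sq_nonneg (1 + r)),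
      pow_pos (sub_pos.2 h2) 2]
  · nlinarith [mul_nonneg (neg_nonneg.2 h) (sq_nonneg (1 + r)),
      mul_nonneg (neg_le_iff_add_nonneg.1 h3) (sq_nonneg (1 - r)),
      pow_pos (neg_lt_iff_pos_add.1 h1) 2]

lemma sph_q_cont {d : ℕ} (i : Fin d) (b : ℝ) :
    ContinuousOn (fun z : ℝ × EuclideanSpace ℝ (Fin d) =>
      (1 + z.1 ^ 2 - 2 * z.1 * z.2 i) ^ b) (Set.Ioo (-1 : ℝ) 1 ×ˢ Metric.sphere 0 1) := by
  apply ContinuousOn.rpow_const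
  · exact Continuous.continuousOn (by fun_prop)
  · intro z hz
    exact Or.inl (sph_q_pos z.1 (z.2 i) hz.1 (sph_coord_mem hz.2 i)).ne'

lemma sph_q_cont' {d : ℕ} (i : Fin d) (b r : ℝ) (hr : r ∈ Set.Ioo (-1 : ℝ) 1) :
    ContinuousOn (fun z : EuclideanSpace ℝ (Fin d) =>
      (1 + r ^ 2 - 2 * r * z i) ^ b) (Metric.sphere 0 1) := by
  apply ContinuousOn.rpow_const
  · exact Continuous.continuousOn (by fun_prop)
  · intro z hz
    exact Or.inl (sph_q_pos r (z i) hr (sph_coord_mem hz i)).ne'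

lemma sph_q_deriv_r (r t b : ℝ) (hq : 0 < 1 + r ^ 2 - 2 * r * t) :
    HasDerivAt (fun y : ℝ => (1 + y ^ 2 - 2 * y * t) ^ b)
      ((2 * r - 2 * t) * b * (1 + r ^ 2 - 2 * r * t) ^ (b - 1)) r := by
  have h1 : HasDerivAt (fun y : ℝ => 1 + y ^ 2 - 2 * y * t) (2 * r - 2 * t) r := by
    exact (((hasDerivAt_pow 2 r).const_add 1).sub
      (((hasDerivAt_id' r).const_mul 2).mul_const t)).congr_deriv (by norm_num)
  exact h1.rpow_const (Or.inl hq.ne')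

lemma sph_q_deriv_t (r t b : ℝ) (hq : 0 < 1 + r ^ 2 - 2 * r * t) :
    HasDerivAt (fun y : ℝ => (1 + r ^ 2 - 2 * r * y) ^ b)
      ((-(2 * r)) * b * (1 + r ^ 2 - 2 * r * t) ^ (b - 1)) t := by
  have h1 : HasDerivAt (fun y : ℝ => 1 + r ^ 2 - 2 * r * y) (-(2 * r)) t := by
    exact (((hasDerivAt_id' t).const_mul (2 * r)).const_sub (1 + r ^ 2)).congr_deriv (by simp)
  exact h1.rpow_const (Or.inl hq.ne')

lemma sph_const (F : ℝ → ℝ) (hF : ∀ r ∈ Set.Ioo (-1 : ℝ) 1, HasDerivAt F 0 r)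
    (r : ℝ) (hr : r ∈ Set.Ioo (-1 : ℝ) 1) : F r = F 0 := by
  apply isOpen_Ioo.is_const_of_deriv_eq_zero isPreconnected_Ioo (s := Set.Ioo (-1 : ℝ) 1) _ _ hr
    (by simp)
  · exact fun x hx => (hF x hx).differentiableAt.differentiableWithinAt
  · exact fun x hx => (hF x hx).deriv

lemma sph_K {n : ℕ} (m : ℝ)
    (hμ : μH[m] (Metric.sphere (0 : EuclideanSpace ℝ (Fin (n + 2))) 1) < ⊤)
    (r : ℝ) (hr : r ∈ Set.Ioo (-1 : ℝ) 1) :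
    ∫ s in Metric.sphere (0 : EuclideanSpace ℝ (Fin (n + 2))) 1,
      r ^ (n + 1) * ((r - s 0) * (1 + r ^ 2 - 2 * r * s 0) ^ (-((n + 2 : ℝ) / 2))) ∂μH[m] = 0 := by
  set a : ℝ := (n + 2 : ℝ) / 2 with ha
  have := sph_const (fun r => ∫ s in Metric.sphere (0 : EuclideanSpace ℝ (Fin (n + 2))) 1,
      r ^ (n + 1) * ((r - s 0) * (1 + r ^ 2 - 2 * r * s 0) ^ (-a)) ∂μH[m]) ?_ r hr
  · rw [this]; simp
  intro r hr
  have hz := sph_zonal m hμ (fun t => (1 + r ^ 2 - 2 * r * t) ^ (-a))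
    (fun t => (-(2 * r)) * (-a) * (1 + r ^ 2 - 2 * r * t) ^ (-a - 1))
    (fun t ht => sph_q_deriv_t r t (-a) (sph_q_pos r t hr ht)) (by
      apply ContinuousOn.mul (by fun_prop)
      apply ContinuousOn.rpow_const (by fun_prop)
      intro t ht
      exact Or.inl (sph_q_pos r t hr ht).ne')
  have hz2 : (0 : ℝ) = ∫ s in Metric.sphere (0 : EuclideanSpace ℝ (Fin (n + 2))) 1,
      (((n + 1 : ℕ) * r ^ n) * ((r - s 0) * (1 + r ^ 2 - 2 * r * s 0) ^ (-a))
        + r ^ (n + 1) * (1 * (1 + r ^ 2 - 2 * r * s 0) ^ (-a)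
          + (r - s 0) * ((2 * r - 2 * s 0) * (-a) * (1 + r ^ 2 - 2 * r * s 0) ^ (-a - 1))))
        ∂μH[m] := by
    refine Eq.trans (sph_aux_zero (r ^ n) hz) ?_
    rw [← integral_const_mul]
    apply setIntegral_congr_fun (isCompact_sphere _ _).measurableSet
    intro s hs
    have hq := sph_q_pos r (s 0) hr (sph_coord_mem hs 0)
    have e : (1 + r ^ 2 - 2 * r * s 0) ^ (-a)
        = (1 + r ^ 2 - 2 * r * s 0) * (1 + r ^ 2 - 2 * r * s 0) ^ (-a - 1) := by
      rw [Real.rpow_sub_one hq.ne', mul_div_cancel₀ _ hq.ne']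
    have ha2 : (n : ℝ) = 2 * a - 2 := by rw [ha]; ring
    simp only [e]
    push_cast
    rw [ha2]
    ring
  rw [hz2]
  refine sph_param_deriv μH[m] (Metric.sphere (0 : EuclideanSpace ℝ (Fin (n + 2))) 1)
    (isCompact_sphere _ _) hμ
    (fun r s => r ^ (n + 1) * ((r - s 0) * (1 + r ^ 2 - 2 * r * s 0) ^ (-a)))
    (fun r s => ((n + 1 : ℕ) * r ^ n) * ((r - s 0) * (1 + r ^ 2 - 2 * r * s 0) ^ (-a))
        + r ^ (n + 1) * (1 * (1 + r ^ 2 - 2 * r * s 0) ^ (-a)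
          + (r - s 0) * ((2 * r - 2 * s 0) * (-a) * (1 + r ^ 2 - 2 * r * s 0) ^ (-a - 1))))
    (Set.Ioo (-1) 1) isOpen_Ioo r hr ?_ ?_ ?_
  · intro x hx s hs
    have hq := sph_q_pos x (s 0) hx (sph_coord_mem hs 0)
    have h1 := hasDerivAt_pow (n + 1) x
    have h2 := ((hasDerivAt_id x).sub_const (s 0)).mul (sph_q_deriv_r x (s 0) (-a) hq)
    exact h1.mul h2
  · intro x hx
    exact ContinuousOn.mul (by fun_prop) (ContinuousOn.mul (Continuous.continuousOn (by fun_prop))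
      (sph_q_cont' 0 (-a) x hx))
  · have e1 := sph_q_cont (0 : Fin (n + 2)) (-a)
    have e2 := sph_q_cont (0 : Fin (n + 2)) (-a - 1)
    have c : ContinuousOn (fun z : ℝ × EuclideanSpace ℝ (Fin (n + 2)) => z.1 - z.2 0)
      (Set.Ioo (-1 : ℝ) 1 ×ˢ Metric.sphere 0 1) := Continuous.continuousOn (by fun_prop)
    have c2 : ContinuousOn (fun z : ℝ × EuclideanSpace ℝ (Fin (n + 2)) =>
      (2 * z.1 - 2 * z.2 0) * (-a))
      (Set.Ioo (-1 : ℝ) 1 ×ˢ Metric.sphere 0 1) := Continuous.continuousOn (by fun_prop)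
    exact (ContinuousOn.mul (by fun_prop) (c.mul e1)).add
      (ContinuousOn.mul (by fun_prop) ((ContinuousOn.mul (by fun_prop) e1).add
        (c.mul (c2.mul e2))))

lemma sph_K' {n : ℕ} (m : ℝ)
    (hμ : μH[m] (Metric.sphere (0 : EuclideanSpace ℝ (Fin (n + 2))) 1) < ⊤)
    (r : ℝ) (hr : r ∈ Set.Ioo (-1 : ℝ) 1) (hr0 : r ≠ 0) :
    ∫ s in Metric.sphere (0 : EuclideanSpace ℝ (Fin (n + 2))) 1,
      (r - s 0) * (1 + r ^ 2 - 2 * r * s 0) ^ (-((n + 2 : ℝ) / 2)) ∂μH[m] = 0 := by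
  have := sph_K m hμ r hr
  rw [integral_const_mul] at this
  exact (mul_eq_zero.1 this).resolve_left (pow_ne_zero _ hr0)

lemma sph_coord_int {n : ℕ} (m : ℝ)
    (hμ : μH[m] (Metric.sphere (0 : EuclideanSpace ℝ (Fin (n + 2))) 1) < ⊤) :
    ∫ s in Metric.sphere (0 : EuclideanSpace ℝ (Fin (n + 2))) 1, s 0 ∂μH[m] = 0 := by
  have := sph_zonal m hμ (fun _ => 1) (fun _ => 0) (fun t _ => hasDerivAt_const _ _)
    continuousOn_const
  simp only [mul_zero, zero_sub, mul_one, integral_neg, neg_eq_zero, integral_const_mul] at this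
  exact (mul_eq_zero.1 this).resolve_left (by positivity)

lemma sph_N {n : ℕ} (m : ℝ)
    (hμ : μH[m] (Metric.sphere (0 : EuclideanSpace ℝ (Fin (n + 2))) 1) < ⊤)
    (r : ℝ) (hr : r ∈ Set.Ioo (-1 : ℝ) 1) :
    ∫ s in Metric.sphere (0 : EuclideanSpace ℝ (Fin (n + 2))) 1,
      (1 + r ^ 2 - 2 * r * s 0) ^ (1 - ((n + 2 : ℝ) / 2)) ∂μH[m]
      = (μH[m] (Metric.sphere (0 : EuclideanSpace ℝ (Fin (n + 2))) 1)).toReal := by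
  set a : ℝ := (n + 2 : ℝ) / 2 with ha
  have := sph_const (fun r => ∫ s in Metric.sphere (0 : EuclideanSpace ℝ (Fin (n + 2))) 1,
      (1 + r ^ 2 - 2 * r * s 0) ^ (1 - a) ∂μH[m]) ?_ r hr
  · rw [this]; simp [Measure.real]
  intro r hr
  have hz2 : (0 : ℝ) = ∫ s in Metric.sphere (0 : EuclideanSpace ℝ (Fin (n + 2))) 1,
      ((2 * r - 2 * s 0) * (1 - a) * (1 + r ^ 2 - 2 * r * s 0) ^ (1 - a - 1)) ∂μH[m] := by
    by_cases hr0 : r = 0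
    · subst hr0
      have h0 := sph_coord_int m hμ
      refine Eq.trans (sph_aux_zero ((-2 * (1 - a))) h0) ?_
      rw [← integral_const_mul]
      congr 1
      funext s
      simp
      ring
    · have h0 := sph_K' m hμ r hr hr0
      refine Eq.trans (sph_aux_zero ((2 * (1 - a))) h0) ?_
      rw [← integral_const_mul]
      congr 1
      funext s
      rw [← ha, show 1 - a - 1 = -a by ring]
      ring
  rw [hz2]
  refine sph_param_deriv μH[m] (Metric.sphere (0 : EuclideanSpace ℝ (Fin (n + 2))) 1)
    (isCompact_sphere _ _) hμ
    (fun r s => (1 + r ^ 2 - 2 * r * s 0) ^ (1 - a))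
    (fun r s => ((2 * r - 2 * s 0) * (1 - a) * (1 + r ^ 2 - 2 * r * s 0) ^ (1 - a - 1)))
    (Set.Ioo (-1) 1) isOpen_Ioo r hr ?_ ?_ ?_
  · intro x hx s hs
    exact sph_q_deriv_r x (s 0) _ (sph_q_pos x (s 0) hx (sph_coord_mem hs 0))
  · intro x hx
    exact sph_q_cont' 0 _ x hx
  · exact ContinuousOn.mul (Continuous.continuousOn (by fun_prop)) (sph_q_cont 0 _)

lemma sph_P {n : ℕ} (m : ℝ)
    (hμ : μH[m] (Metric.sphere (0 : EuclideanSpace ℝ (Fin (n + 2))) 1) < ⊤)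
    (r : ℝ) (hr : r ∈ Set.Ioo (-1 : ℝ) 1) (hr0 : r ≠ 0) :
    (1 - r ^ 2) * ∫ s in Metric.sphere (0 : EuclideanSpace ℝ (Fin (n + 2))) 1,
      (1 + r ^ 2 - 2 * r * s 0) ^ (-((n + 2 : ℝ) / 2)) ∂μH[m]
      = (μH[m] (Metric.sphere (0 : EuclideanSpace ℝ (Fin (n + 2))) 1)).toReal := by
  have h1 := sph_N m hμ r hr
  have h2 := sph_K' m hμ r hr hr0
  set a : ℝ := (n + 2 : ℝ) / 2 with ha
  rw [← integral_const_mul, ← h1]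
  have h3 : ∫ s in Metric.sphere (0 : EuclideanSpace ℝ (Fin (n + 2))) 1,
      (1 + r ^ 2 - 2 * r * s 0) ^ (1 - a) ∂μH[m]
      = ∫ s in Metric.sphere (0 : EuclideanSpace ℝ (Fin (n + 2))) 1,
      ((1 + r ^ 2 - 2 * r * s 0) ^ (1 - a)
        - 2 * r * ((r - s 0) * (1 + r ^ 2 - 2 * r * s 0) ^ (-a))) ∂μH[m] := by
    rw [integral_sub, integral_const_mul, h2, mul_zero, sub_zero]
    · exact sph_integrable m hμ _ (sph_q_cont' 0 _ r hr)
    · apply sph_integrable m hμ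
      exact ContinuousOn.mul (by fun_prop) (ContinuousOn.mul (Continuous.continuousOn (by fun_prop))
        (sph_q_cont' 0 _ r hr))
  rw [h3]
  apply setIntegral_congr_fun (isCompact_sphere _ _).measurableSet
  intro s hs
  have hq := sph_q_pos r (s 0) hr (sph_coord_mem hs 0)
  have e : (1 + r ^ 2 - 2 * r * s 0) ^ (1 - a)
      = (1 + r ^ 2 - 2 * r * s 0) * (1 + r ^ 2 - 2 * r * s 0) ^ (-a) := by
    rw [sub_eq_add_neg 1 a, Real.rpow_add hq, Real.rpow_one]
  simp only [e]
  ring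

/-- For `d ≥ 3` and `R > 1`, the average of `|s - R e₁|^{-d}` over the unit sphere
`S^{d-1}` in `ℝ^d` equals `R^{2-d}/(R²-1)`. -/
theorem sphere_average_inv_dist_pow_of_one_lt
    (d : ℕ) (hd : 3 ≤ d) (R : ℝ) (hR : 1 < R) :
    (1 / (μH[(d : ℝ) - 1] (Metric.sphere (0 : EuclideanSpace ℝ (Fin d)) 1)).toReal) *
      ∫ s in Metric.sphere (0 : EuclideanSpace ℝ (Fin d)) 1,
        ‖s - R • EuclideanSpace.single (⟨0, by omega⟩ : Fin d) (1 : ℝ)‖ ^ (-(d : ℝ))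
        ∂(μH[(d : ℝ) - 1])
    = R ^ ((2 : ℝ) - d) / (R ^ 2 - 1) := by
  obtain ⟨n, rfl⟩ : ∃ n, d = n + 2 := ⟨d - 2, by omega⟩
  have hdim : (((n + 2 : ℕ) : ℝ) - 1) = ((n + 1 : ℕ) : ℝ) := by push_cast; ring
  rw [hdim]
  have hfr : Module.finrank ℝ (EuclideanSpace ℝ (Fin (n + 2))) = (n + 1) + 1 := by simp
  have hfin := sph_finite (E := EuclideanSpace ℝ (Fin (n + 2))) (n + 1) hfr
  have hpos := sph_pos (E := EuclideanSpace ℝ (Fin (n + 2))) (n + 1) hfr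
    (EuclideanSpace.single 0 (1 : ℝ)) (by simp)
  set M : ℝ := (μH[((n + 1 : ℕ) : ℝ)]
    (Metric.sphere (0 : EuclideanSpace ℝ (Fin (n + 2))) 1)).toReal with hM
  have hM0 : 0 < M := ENNReal.toReal_pos hpos.ne' hfin.ne
  have hR0 : 0 < R := by linarith
  have hr : R⁻¹ ∈ Set.Ioo (-1 : ℝ) 1 :=
    ⟨by have := inv_pos.2 hR0; linarith, inv_lt_one_of_one_lt₀ hR⟩
  have hP := sph_P _ hfin R⁻¹ hr (inv_ne_zero hR0.ne')
  rw [← hM] at hP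
  have hI : ∫ s in Metric.sphere (0 : EuclideanSpace ℝ (Fin (n + 2))) 1,
      ‖s - R • EuclideanSpace.single (⟨0, by omega⟩ : Fin (n + 2)) (1 : ℝ)‖ ^ (-((n + 2 : ℕ) : ℝ))
        ∂(μH[((n + 1 : ℕ) : ℝ)])
      = R ^ (-((n + 2 : ℕ) : ℝ)) * ∫ s in Metric.sphere (0 : EuclideanSpace ℝ (Fin (n + 2))) 1,
      (1 + R⁻¹ ^ 2 - 2 * R⁻¹ * s 0) ^ (-((n + 2 : ℝ) / 2)) ∂(μH[((n + 1 : ℕ) : ℝ)]) := by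
    rw [← integral_const_mul]
    apply setIntegral_congr_fun (isCompact_sphere _ _).measurableSet
    intro s hs
    have hq := sph_q_pos R⁻¹ (s 0) hr (sph_coord_mem hs 0)
    have hs1 : ‖s‖ = 1 := by simpa using hs
    have e : ‖s - R • EuclideanSpace.single (⟨0, by omega⟩ : Fin (n + 2)) (1 : ℝ)‖ ^ 2
        = R ^ 2 * (1 + R⁻¹ ^ 2 - 2 * R⁻¹ * s 0) := by
      rw [norm_sub_sq_real, inner_smul_right, norm_smul, EuclideanSpace.inner_single_right, hs1]
      simp only [PiLp.norm_single, norm_one, Real.norm_eq_abs, mul_one, sq_abs, one_mul]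
      simp
      field_simp
      ring
    have e2 : ‖s - R • EuclideanSpace.single (⟨0, by omega⟩ : Fin (n + 2)) (1 : ℝ)‖
        = R * (1 + R⁻¹ ^ 2 - 2 * R⁻¹ * s 0) ^ (1 / 2 : ℝ) := by
      rw [← Real.sqrt_eq_rpow, ← Real.sqrt_sq (norm_nonneg (s - _)), e,
        Real.sqrt_mul (sq_nonneg R), Real.sqrt_sq hR0.le]
    simp only [e2]
    rw [Real.mul_rpow hR0.le (Real.rpow_nonneg hq.le _), ← Real.rpow_mul hq.le]
    congr 2
    push_cast
    ring
  rw [hI]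
  have hR2 : 0 < R ^ 2 - 1 := by nlinarith
  have hrr : 1 - R⁻¹ ^ 2 = (R ^ 2 - 1) / R ^ 2 := by field_simp
  rw [hrr] at hP
  have e3 : R ^ ((2 : ℝ) - ((n + 2 : ℕ) : ℝ)) = R ^ 2 * R ^ (-((n + 2 : ℕ) : ℝ)) := by
    rw [sub_eq_add_neg, Real.rpow_add hR0, Real.rpow_two]
  rw [e3]
  generalize R ^ (-((n + 2 : ℕ) : ℝ)) = A
  generalize (∫ s in Metric.sphere (0 : EuclideanSpace ℝ (Fin (n + 2))) 1,
      (1 + R⁻¹ ^ 2 - 2 * R⁻¹ * s 0) ^ (-((n + 2 : ℝ) / 2)) ∂(μH[((n + 1 : ℕ) : ℝ)])) = I at hP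
  have hP2 : (R ^ 2 - 1) * I = M * R ^ 2 := by
    field_simp at hP
    linarith
  field_simp
  linear_combination A * hP2
end

section
/- For d ≥ 3 and 0 < R < 1, the average of |s - R e₁|^{-d} over the unit sphere S^{d-1} in ℝ^d equals 1/(1-R²); that is, (1/|S^{d-1}|) ∫_{S^{d-1}} |s - R e₁|^{-d} dσ(s) = 1/(1-R²). -/
open MeasureTheory Real

namespace SphAvg

lemma param {X : Type*} [TopologicalSpace X] [T2Space X] [MeasurableSpace X] [BorelSpace X]
    [SecondCountableTopology X]
    (μ : Measure X) [IsFiniteMeasure μ] {S : Set X} (hS : IsCompact S)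
    {I : Set ℝ} (hI : IsOpen I) (F F' : ℝ → X → ℝ)
    (hd : ∀ x ∈ I, ∀ s ∈ S, HasDerivAt (fun x => F x s) (F' x s) x)
    (hc : ∀ x ∈ I, ContinuousOn (F x) S)
    (hc' : ContinuousOn (Function.uncurry F') (I ×ˢ S)) {x : ℝ} (hx : x ∈ I) :
    HasDerivAt (fun y => ∫ s in S, F y s ∂μ) (∫ s in S, F' x s ∂μ) x := by
  obtain ⟨ε, hε, hsub⟩ := Metric.nhds_basis_closedBall.mem_iff.1 (hI.mem_nhds hx)
  have hK : IsCompact (Metric.closedBall x ε ×ˢ S) := (isCompact_closedBall x ε).prod hS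
  obtain ⟨C, hC⟩ := hK.exists_bound_of_continuousOn (hc'.mono (Set.prod_mono hsub subset_rfl))
  have hm := hS.measurableSet
  refine (hasDerivAt_integral_of_dominated_loc_of_deriv_le (bound := fun _ => C)
    (Metric.closedBall_mem_nhds x hε) ?_ ?_ ?_ ?_ (integrable_const _) ?_).2
  · filter_upwards [hI.mem_nhds hx] with y hy
    exact (hc y hy).aestronglyMeasurable hm
  · exact (hc x hx).integrableOn_compact hS
  · refine ContinuousOn.aestronglyMeasurable ?_ hm
    exact hc'.comp (f := fun s => (x, s)) (by fun_prop) (fun s hs => ⟨hx, hs⟩)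
  · filter_upwards [ae_restrict_mem hm] with s hs y hy
    exact hC (y, s) ⟨hy, hs⟩
  · filter_upwards [ae_restrict_mem hm] with s hs y hy
    exact hd y (hsub hy) s hs

abbrev E (m : ℕ) := EuclideanSpace ℝ (Fin (m + 3))
abbrev S (m : ℕ) : Set (E m) := Metric.sphere 0 1

noncomputable def v (m : ℕ) (j : Fin (m+2)) (θ : ℝ) : E m :=
  cos θ • EuclideanSpace.single 0 1 + sin θ • EuclideanSpace.single j.succ 1

lemma norm_v (m : ℕ) (j) (θ) : ‖v m j θ‖ = 1 := by
  have : ‖v m j θ‖ ^ 2 = 1 := by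
    rw [EuclideanSpace.real_norm_sq_eq, Fin.sum_univ_succ]
    have := cos_sq_add_sin_sq θ
    simp [v, Fin.succ_ne_zero, (Fin.succ_ne_zero _).symm]
  nlinarith [norm_nonneg (v m j θ)]

lemma inner_v (m : ℕ) (j) (θ) (s : E m) :
    inner ℝ (v m j θ) s = cos θ * s 0 + sin θ * s j.succ := by
  simp [v, inner_add_left, inner_smul_left, EuclideanSpace.inner_single_left]

noncomputable def refl (m : ℕ) (j : Fin (m+2)) (θ : ℝ) : E m ≃ₗᵢ[ℝ] E m :=
  (Submodule.span ℝ {v m j θ}).reflection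

lemma refl_zero (m : ℕ) (j) (θ) (s : E m) :
    refl m j θ s 0 = 2 * (cos θ * s 0 + sin θ * s j.succ) * cos θ - s 0 := by
  rw [refl, Submodule.reflection_singleton_apply, norm_v, inner_v]
  simp [v, (Fin.succ_ne_zero _).symm]
  ring

lemma refl_succ (m : ℕ) (j) (θ) (s : E m) :
    refl m j θ s j.succ = 2 * (cos θ * s 0 + sin θ * s j.succ) * sin θ - s j.succ := by
  rw [refl, Submodule.reflection_singleton_apply, norm_v, inner_v]
  simp [v, (Fin.succ_ne_zero _)]
  ring

lemma coord_mem {m : ℕ} {s : E m} (hs : s ∈ S m) (i) : s i ∈ Set.Icc (-1:ℝ) 1 := by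
  have h := PiLp.norm_apply_le s i
  rw [mem_sphere_zero_iff_norm.1 hs] at h
  exact abs_le.1 h

lemma integral_refl (m : ℕ) (j) (θ : ℝ) (p : ℝ) (f : E m → ℝ) :
    ∫ s in S m, f (refl m j θ s) ∂μH[p] = ∫ s in S m, f s ∂μH[p] := by
  have h := (refl m j θ).toIsometryEquiv.measurePreserving_hausdorffMeasure p
  have := h.setIntegral_preimage_emb
    ((refl m j θ).toHomeomorph.measurableEmbedding) f (S m)
  rw [← this]
  congr 2
  ext s
  simp

lemma stein_j (m : ℕ) (j : Fin (m+2)) (p : ℝ)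
    (μ : Measure (E m)) [IsFiniteMeasure μ]
    (hμ : μ.restrict (S m) = (μH[p]).restrict (S m))
    (h h' : ℝ → ℝ)
    (hh : ∀ t ∈ Set.Icc (-1:ℝ) 1, HasDerivAt h (h' t) t) (hc : ContinuousOn h' (Set.Icc (-1) 1)) :
    ∫ s in S m, (s 0 * h (s 0) - s j.succ ^ 2 * h' (s 0)) ∂μ = 0 := by
  have hch : ContinuousOn h (Set.Icc (-1) 1) := fun t ht => (hh t ht).continuousAt.continuousWithinAt
  set g : ℝ → E m → ℝ := fun θ s => 2 * (cos θ * s 0 + sin θ * s j.succ) * cos θ - s 0 with hg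
  set k : ℝ → E m → ℝ := fun θ s => 2 * (cos θ * s 0 + sin θ * s j.succ) * sin θ - s j.succ with hk
  set g' : ℝ → E m → ℝ := fun θ s => 2 * (-sin θ * s 0 + cos θ * s j.succ) * cos θ
    + 2 * (cos θ * s 0 + sin θ * s j.succ) * (-sin θ) with hg'
  set k' : ℝ → E m → ℝ := fun θ s => 2 * (-sin θ * s 0 + cos θ * s j.succ) * sin θ
    + 2 * (cos θ * s 0 + sin θ * s j.succ) * (cos θ) with hk'
  have gmem : ∀ θ, ∀ s ∈ S m, g θ s ∈ Set.Icc (-1:ℝ) 1 := by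
    intro θ s hs
    rw [hg]; simp only
    rw [← refl_zero]
    apply coord_mem
    simpa using hs
  have gd : ∀ θ s, HasDerivAt (fun θ => g θ s) (g' θ s) θ := by
    intro θ s
    have := (((((hasDerivAt_cos θ).mul_const (s 0)).add
      ((hasDerivAt_sin θ).mul_const (s j.succ))).const_mul 2).mul (hasDerivAt_cos θ)).sub_const (s 0)
    exact this
  have kd : ∀ θ s, HasDerivAt (fun θ => k θ s) (k' θ s) θ := by
    intro θ s
    have := (((((hasDerivAt_cos θ).mul_const (s 0)).add
      ((hasDerivAt_sin θ).mul_const (s j.succ))).const_mul 2).mul (hasDerivAt_sin θ)).sub_const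
        (s j.succ)
    exact this
  have cg : Continuous (Function.uncurry g) := by
    simp only [hg, Function.uncurry_def]; fun_prop
  have ck : Continuous (Function.uncurry k) := by
    simp only [hk, Function.uncurry_def]; fun_prop
  have cg' : Continuous (Function.uncurry g') := by
    simp only [hg', Function.uncurry_def]; fun_prop
  have ck' : Continuous (Function.uncurry k') := by
    simp only [hk', Function.uncurry_def]; fun_prop
  have hS : IsCompact (S m) := isCompact_sphere _ _
  have key := param μ hS (I := Set.univ) isOpen_univ (fun θ s => k θ s * h (g θ s))
    (fun θ s => k' θ s * h (g θ s) + k θ s * (h' (g θ s) * g' θ s))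
    (fun θ _ s hs => (kd θ s).mul ((hh _ (gmem θ s hs)).comp θ (gd θ s)))
    (by
      intro θ _
      refine ContinuousOn.mul ?_ (hch.comp ?_ (fun s hs => gmem θ s hs))
      · exact (ck.comp (by fun_prop : Continuous fun s => (θ, s))).continuousOn
      · exact (cg.comp (by fun_prop : Continuous fun s => (θ, s))).continuousOn)
    (by
      have h1 : ContinuousOn (fun q : ℝ × E m => h (Function.uncurry g q)) (Set.univ ×ˢ S m) :=
        hch.comp cg.continuousOn (fun q hq => gmem q.1 q.2 hq.2)
      have h2 : ContinuousOn (fun q : ℝ × E m => h' (Function.uncurry g q)) (Set.univ ×ˢ S m) :=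
        hc.comp cg.continuousOn (fun q hq => gmem q.1 q.2 hq.2)
      exact (ck'.continuousOn.mul h1).add (ck.continuousOn.mul (h2.mul cg'.continuousOn)))
    (Set.mem_univ 0)
  have hconst : (fun θ => ∫ s in S m, k θ s * h (g θ s) ∂μ) =
      fun _ => ∫ s in S m, s j.succ * h (s 0) ∂μ := by
    funext θ
    have := integral_refl m j θ p (fun s => s j.succ * h (s 0))
    simp only [refl_zero, refl_succ] at this
    rw [hμ]
    exact this
  rw [hconst] at key
  have h0 := key.unique (hasDerivAt_const _ _)
  simp only [hg, hk, hg', hk'] at h0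
  simp only [sin_zero, cos_zero] at h0
  have : ∫ s in S m, 2 * (s 0 * h (s 0) - s j.succ ^ 2 * h' (s 0)) ∂μ = 0 := by
    rw [← h0]
    congr 1
    funext s
    ring_nf
  rw [integral_const_mul] at this
  linarith

lemma stein (m : ℕ) (p : ℝ)
    (μ : Measure (E m)) [IsFiniteMeasure μ]
    (hμ : μ.restrict (S m) = (μH[p]).restrict (S m))
    (h h' : ℝ → ℝ)
    (hh : ∀ t ∈ Set.Icc (-1:ℝ) 1, HasDerivAt h (h' t) t) (hc : ContinuousOn h' (Set.Icc (-1) 1)) :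
    ∫ s in S m, ((m + 2) * s 0 * h (s 0) - (1 - s 0 ^ 2) * h' (s 0)) ∂μ = 0 := by
  have hch : ContinuousOn h (Set.Icc (-1) 1) := fun t ht => (hh t ht).continuousAt.continuousWithinAt
  have hS : IsCompact (S m) := isCompact_sphere _ _
  have h1 : ∫ s in S m, ∑ j : Fin (m+2), (s 0 * h (s 0) - s j.succ ^ 2 * h' (s 0)) ∂μ = 0 := by
    rw [integral_finsetSum]
    · exact Finset.sum_eq_zero fun j _ => stein_j m j p μ hμ h h' hh hc
    · intro j _
      refine ContinuousOn.integrableOn_compact hS ?_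
      have a1 : ContinuousOn (fun s : E m => h (s 0)) (S m) :=
        hch.comp (by fun_prop) (fun s hs => coord_mem hs 0)
      have a2 : ContinuousOn (fun s : E m => h' (s 0)) (S m) :=
        hc.comp (by fun_prop) (fun s hs => coord_mem hs 0)
      exact ((by fun_prop : Continuous fun s : E m => s 0).continuousOn.mul a1).sub
        ((by fun_prop : Continuous fun s : E m => s j.succ ^ 2).continuousOn.mul a2)
  rw [← h1]
  refine setIntegral_congr_fun hS.measurableSet ?_
  intro s hs
  have hn : ‖s‖ ^ 2 = 1 := by rw [mem_sphere_zero_iff_norm.1 hs]; norm_num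
  rw [EuclideanSpace.real_norm_sq_eq, Fin.sum_univ_succ] at hn
  simp only [Finset.sum_sub_distrib, ← Finset.sum_mul]
  rw [← hn]
  simp

lemma haus_eq (m : ℕ) : (μH[(m:ℝ)+2] : Measure (Fin (m+2) → ℝ)) = volume := by
  rw [← hausdorffMeasure_pi_real]; simp

lemma pos (m : ℕ) : μH[(m:ℝ)+2] (S m) ≠ 0 := by
  intro h0
  let pr : E m → (Fin (m+2) → ℝ) := fun s j => s j.succ
  have hl : LipschitzWith 1 pr := by
    refine LipschitzWith.of_dist_le_mul fun x y => ?_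
    rw [NNReal.coe_one, one_mul, dist_pi_le_iff dist_nonneg]
    intro j
    have := PiLp.norm_apply_le (x - y) j.succ
    simpa [dist_eq_norm] using this
  have h1 := hl.hausdorffMeasure_image_le (d := (m:ℝ)+2) (by positivity) (S m)
  rw [h0, haus_eq] at h1
  have h2 : Metric.ball (0 : Fin (m+2) → ℝ) ((m+2:ℝ)⁻¹) ⊆ pr '' S m := by
    intro y hy
    rw [mem_ball_zero_iff] at hy
    have hq : ∑ j, y j ^ 2 ≤ 1 := by
      calc ∑ j, y j ^ 2 ≤ ∑ j : Fin (m+2), (m+2:ℝ)⁻¹ := by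
            refine Finset.sum_le_sum fun j _ => ?_
            have a := (norm_le_pi_norm y j).trans hy.le
            have b : (m+2:ℝ)⁻¹ ≤ 1 := inv_le_one_of_one_le₀ (by linarith [(Nat.cast_nonneg m : (0:ℝ) ≤ m)])
            rw [Real.norm_eq_abs] at a
            rw [← sq_abs]
            nlinarith [abs_nonneg (y j)]
        _ = 1 := by simp; field_simp
    refine ⟨WithLp.toLp 2 (Fin.cons (√(1 - ∑ j, y j ^ 2)) y), ?_, ?_⟩
    · rw [mem_sphere_zero_iff_norm, EuclideanSpace.norm_eq, Fin.sum_univ_succ]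
      simp [sq_sqrt (by linarith : 0 ≤ 1 - ∑ j, y j ^ 2)]
    · funext j; simp [pr]
  have h3 : volume (Metric.ball (0 : Fin (m+2) → ℝ) ((m+2:ℝ)⁻¹)) ≤ 0 := by
    refine (measure_mono h2).trans (h1.trans ?_)
    simp
  exact absurd h3 (not_le.2 (Metric.measure_ball_pos _ _ (by positivity)))

lemma fin (m : ℕ) : μH[(m:ℝ)+2] (S m) ≠ ⊤ := by
  let z : Fin (m+3) → ℝ → (Fin (m+2) → ℝ) → E m := fun i ε y => WithLp.toLp 2 (i.insertNth ε y)
  let g : Fin (m+3) → ℝ → (Fin (m+2) → ℝ) → E m := fun i ε y => ‖z i ε y‖⁻¹ • z i ε y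
  let K : Set (Fin (m+2) → ℝ) := Metric.closedBall 0 1
  have hz : ∀ i ε, ContDiff ℝ 1 (z i ε) := by
    intro i ε
    rw [contDiff_euclidean]
    intro k
    induction k using i.succAboveCases with
    | x => simpa [z] using contDiff_const
    | p k => simp only [z, Fin.insertNth_apply_succAbove]; fun_prop
  have hz0 : ∀ i ε y, ε ≠ 0 → z i ε y ≠ 0 := by
    intro i ε y hε h
    apply hε
    have := congrArg (fun w : E m => w i) h
    simpa [z] using this
  have hg : ∀ i ε, ε ≠ 0 → ContDiff ℝ 1 (g i ε) := by
    intro i ε hε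
    refine ContDiff.smul (ContDiff.inv ((hz i ε).norm ℝ (fun y => hz0 i ε y hε)) ?_) (hz i ε)
    intro y
    exact norm_ne_zero_iff.2 (hz0 i ε y hε)
  have hfin : ∀ i ε, ε ≠ 0 → μH[(m:ℝ)+2] (g i ε '' K) < ⊤ := by
    intro i ε hε
    obtain ⟨C, hC⟩ := ((hg i ε hε).locallyLipschitz.locallyLipschitzOn (s := K)).exists_lipschitzOnWith_of_compact
      (isCompact_closedBall _ _)
    refine (hC.hausdorffMeasure_image_le (by positivity)).trans_lt ?_
    rw [haus_eq]
    refine ENNReal.mul_lt_top (ENNReal.rpow_lt_top_of_nonneg (by positivity) (by simp)) ?_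
    exact (isCompact_closedBall _ _).measure_lt_top
  have hcov : S m ⊆ ⋃ i, (g i 1 '' K ∪ g i (-1) '' K) := by
    intro s hs
    rw [mem_sphere_zero_iff_norm] at hs
    obtain ⟨i, -, hi⟩ := Finset.exists_max_image Finset.univ (fun i => |s i|) ⟨0, Finset.mem_univ _⟩
    have hpos : 0 < |s i| := by
      by_contra hcon
      have : s = 0 := by
        ext k
        have := hi k (Finset.mem_univ _)
        have h0 : |s k| ≤ 0 := by linarith
        simpa using h0
      simp [this] at hs
    rw [Set.mem_iUnion]
    refine ⟨i, ?_⟩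
    have main : ∀ ε : ℝ, |s i| * ε = s i → s ∈ g i ε '' K := by
      intro ε hε
      refine ⟨fun k => |s i|⁻¹ * s (i.succAbove k), ?_, ?_⟩
      · rw [mem_closedBall_zero_iff, pi_norm_le_iff_of_nonneg zero_le_one]
        intro k
        rw [norm_mul, norm_inv, Real.norm_eq_abs, Real.norm_eq_abs, abs_abs]
        rw [inv_mul_le_iff₀ hpos, mul_one]
        exact hi _ (Finset.mem_univ _)
      · have : z i ε (fun k => |s i|⁻¹ * s (i.succAbove k)) = |s i|⁻¹ • s := by
          ext k
          induction k using i.succAboveCases with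
          | x => simp [z]; field_simp; linarith
          | p k => simp [z]
        simp only [g, this, norm_smul, hs]
        simp [smul_smul, hpos.ne']
    rcases le_total 0 (s i) with h | h
    · left; apply main; rw [abs_of_nonneg h, mul_one]
    · right; apply main; rw [abs_of_nonpos h]; ring
  refine ((measure_mono hcov).trans_lt ?_).ne
  refine (measure_iUnion_le _).trans_lt ?_
  rw [tsum_fintype, ENNReal.sum_lt_top]
  intro i _
  exact (measure_union_le _ _).trans_lt (ENNReal.add_lt_top.2 ⟨hfin i 1 (by simp), hfin i (-1) (by simp)⟩)


lemma u_pos {R t : ℝ} (hR : R ∈ Set.Ioo (-1:ℝ) 1) (ht : t ∈ Set.Icc (-1:ℝ) 1) :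
    0 < 1 + R ^ 2 - 2 * R * t := by
  obtain ⟨h1, h2⟩ := hR
  obtain ⟨h3, h4⟩ := ht
  nlinarith [mul_pos (by linarith : 0 < 1 + R) (by linarith : 0 < 1 - R), sq_nonneg (R - t),
    mul_nonneg (by linarith : 0 ≤ 1 + t) (by linarith : 0 ≤ 1 - t)]

noncomputable def W (m : ℕ) (R t : ℝ) : ℝ :=
  (m + 2) * t * (1 + R ^ 2 - 2 * R * t) ^ (-((m:ℝ) + 3) / 2) -
  (1 - t ^ 2) * ((m + 3) * R * (1 + R ^ 2 - 2 * R * t) ^ (-((m:ℝ) + 3) / 2 - 1))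

noncomputable def K1 (m : ℕ) (R t : ℝ) : ℝ :=
  (1 - R ^ 2) * (1 + R ^ 2 - 2 * R * t) ^ (-((m:ℝ) + 3) / 2) +
    (1 + R ^ 2 - 2 * R * t) ^ (-((m:ℝ) + 3) / 2 + 1)

noncomputable def K2 (m : ℕ) (R t : ℝ) : ℝ :=
  R ^ (m + 1) * ((1 + R ^ 2 - 2 * R * t) ^ (-((m:ℝ) + 3) / 2 + 1) -
    (1 - R ^ 2) * (1 + R ^ 2 - 2 * R * t) ^ (-((m:ℝ) + 3) / 2))

lemma du (R t : ℝ) : HasDerivAt (fun R : ℝ => 1 + R ^ 2 - 2 * R * t) (2 * R - 2 * t) R := by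
  have := (((hasDerivAt_pow 2 R).const_add 1).sub (((hasDerivAt_id R).const_mul 2).mul_const t))
  refine HasDerivAt.congr_deriv this (Eq.symm ?_)
  simp

lemma dq (R : ℝ) : HasDerivAt (fun R : ℝ => 1 - R ^ 2) (- (2 * R)) R := by
  have := (hasDerivAt_pow 2 R).const_sub 1
  refine HasDerivAt.congr_deriv this (Eq.symm ?_)
  simp

lemma dK1 (m : ℕ) {R t : ℝ} (hR : R ∈ Set.Ioo (-1:ℝ) 1) (ht : t ∈ Set.Icc (-1:ℝ) 1) :
    HasDerivAt (fun R => K1 m R t) (2 * W m R t) R := by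
  have hu := u_pos hR ht
  have := ((dq R).mul ((du R t).rpow_const (p := -((m:ℝ) + 3) / 2) (Or.inl hu.ne'))).add
    ((du R t).rpow_const (p := -((m:ℝ) + 3) / 2 + 1) (Or.inl hu.ne'))
  refine HasDerivAt.congr_deriv this (Eq.symm ?_)
  have e1 : (1 + R ^ 2 - 2 * R * t) ^ (-((m:ℝ) + 3) / 2) =
      (1 + R ^ 2 - 2 * R * t) ^ (-((m:ℝ) + 3) / 2 - 1) * (1 + R ^ 2 - 2 * R * t) := by
    rw [rpow_sub_one hu.ne', div_mul_cancel₀ _ hu.ne']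
  rw [W, add_sub_cancel_right, e1]
  generalize (1 + R ^ 2 - 2 * R * t) ^ (-((m:ℝ) + 3) / 2 - 1) = X
  ring

lemma dK2 (m : ℕ) {R t : ℝ} (hR : R ∈ Set.Ioo (-1:ℝ) 1) (ht : t ∈ Set.Icc (-1:ℝ) 1) :
    HasDerivAt (fun R => K2 m R t) (- 2 * R ^ (m + 1) * W m R t) R := by
  have hu := u_pos hR ht
  have := (hasDerivAt_pow (m + 1) R).mul
    (((du R t).rpow_const (p := -((m:ℝ) + 3) / 2 + 1) (Or.inl hu.ne')).sub
    ((dq R).mul ((du R t).rpow_const (p := -((m:ℝ) + 3) / 2) (Or.inl hu.ne'))))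
  refine HasDerivAt.congr_deriv this (Eq.symm ?_)
  have e1 : (1 + R ^ 2 - 2 * R * t) ^ (-((m:ℝ) + 3) / 2) =
      (1 + R ^ 2 - 2 * R * t) ^ (-((m:ℝ) + 3) / 2 - 1) * (1 + R ^ 2 - 2 * R * t) := by
    rw [rpow_sub_one hu.ne', div_mul_cancel₀ _ hu.ne']
  have e2 := rpow_add_one hu.ne' (-((m:ℝ) + 3) / 2)
  simp only [W, add_sub_cancel_right, Pi.sub_apply, Pi.mul_apply]
  rw [e2, e1]
  generalize (1 + R ^ 2 - 2 * R * t) ^ (-((m:ℝ) + 3) / 2 - 1) = X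
  push_cast
  ring

lemma contpow (p : ℝ) (m : ℕ) : ContinuousOn
    (fun q : ℝ × E m => (1 + q.1 ^ 2 - 2 * q.1 * q.2 0) ^ p) (Set.Ioo (-1) 1 ×ˢ S m) := by
  refine ContinuousOn.rpow_const ?_ ?_
  · exact Continuous.continuousOn (by fun_prop)
  · intro q hq
    exact Or.inl (u_pos hq.1 (coord_mem hq.2 0)).ne'

lemma contW (m : ℕ) : ContinuousOn (fun q : ℝ × E m => W m q.1 (q.2 0)) (Set.Ioo (-1) 1 ×ˢ S m) := by
  unfold W
  have h1 := contpow (-((m:ℝ) + 3) / 2) m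
  have h2 := contpow (-((m:ℝ) + 3) / 2 - 1) m
  refine ContinuousOn.sub (ContinuousOn.mul (Continuous.continuousOn (by fun_prop)) h1)
    (ContinuousOn.mul (Continuous.continuousOn (by fun_prop))
      (ContinuousOn.mul (Continuous.continuousOn (by fun_prop)) h2))

lemma contpow' (p : ℝ) (m : ℕ) {R : ℝ} (hR : R ∈ Set.Ioo (-1:ℝ) 1) : ContinuousOn
    (fun s : E m => (1 + R ^ 2 - 2 * R * s 0) ^ p) (S m) :=
  (contpow p m).comp (f := fun s => (R, s)) (by fun_prop) (fun s hs => ⟨hR, hs⟩)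

lemma contK1 (m : ℕ) {R : ℝ} (hR : R ∈ Set.Ioo (-1:ℝ) 1) :
    ContinuousOn (fun s : E m => K1 m R (s 0)) (S m) := by
  unfold K1
  exact (continuousOn_const.mul (contpow' _ m hR)).add (contpow' _ m hR)

lemma contK2 (m : ℕ) {R : ℝ} (hR : R ∈ Set.Ioo (-1:ℝ) 1) :
    ContinuousOn (fun s : E m => K2 m R (s 0)) (S m) := by
  unfold K2
  exact continuousOn_const.mul ((contpow' _ m hR).sub (continuousOn_const.mul (contpow' _ m hR)))

lemma intW (m : ℕ) (p : ℝ)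
    (μ : Measure (E m)) [IsFiniteMeasure μ]
    (hμ : μ.restrict (S m) = (μH[p]).restrict (S m)) {R : ℝ} (hR : R ∈ Set.Ioo (-1:ℝ) 1) :
    ∫ s in S m, W m R (s 0) ∂μ = 0 := by
  refine stein m p μ hμ (fun t => (1 + R ^ 2 - 2 * R * t) ^ (-((m:ℝ) + 3) / 2))
    (fun t => (m + 3) * R * (1 + R ^ 2 - 2 * R * t) ^ (-((m:ℝ) + 3) / 2 - 1)) ?_ ?_
  · intro t ht
    have hd : HasDerivAt (fun t : ℝ => 1 + R ^ 2 - 2 * R * t) (- (2 * R)) t := by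
      simpa using ((hasDerivAt_id t).const_mul (2 * R)).const_sub (1 + R ^ 2)
    convert hd.rpow_const (p := -((m:ℝ) + 3) / 2) (Or.inl (u_pos hR ht).ne') using 1
    ring
  · refine continuousOn_const.mul (ContinuousOn.rpow_const
      (Continuous.continuousOn (by fun_prop)) ?_)
    intro t ht
    exact Or.inl (u_pos hR ht).ne'

lemma const_of (f : ℝ → ℝ) (hf : ∀ x ∈ Set.Ioo (-1:ℝ) 1, HasDerivAt f 0 x) {R : ℝ}
    (hR : R ∈ Set.Ioo (-1:ℝ) 1) : f R = f 0 :=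
  isOpen_Ioo.is_const_of_deriv_eq_zero isPreconnected_Ioo
    (fun x hx => (hf x hx).differentiableAt.differentiableWithinAt)
    (fun x hx => (hf x hx).deriv) hR (by norm_num)

lemma main (m : ℕ) (p : ℝ)
    (μ : Measure (E m)) [IsFiniteMeasure μ]
    (hμ : μ.restrict (S m) = (μH[p]).restrict (S m)) {R : ℝ} (hR0 : 0 < R) (hR1 : R < 1) :
    (1 - R ^ 2) * ∫ s in S m, (1 + R ^ 2 - 2 * R * s 0) ^ (-((m:ℝ) + 3) / 2) ∂μ
      = μ.real (S m) := by
  have hS : IsCompact (S m) := isCompact_sphere _ _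
  have hR : R ∈ Set.Ioo (-1:ℝ) 1 := ⟨by linarith, hR1⟩
  have h1 : ∫ s in S m, K1 m R (s 0) ∂μ = ∫ s in S m, K1 m 0 (s 0) ∂μ := by
    refine const_of (fun R => ∫ s in S m, K1 m R (s 0) ∂μ) ?_ hR
    intro x hx
    have := param μ hS isOpen_Ioo (fun R s => K1 m R (s 0)) (fun R s => 2 * W m R (s 0))
      (fun x hx s hs => dK1 m hx (coord_mem hs 0)) (fun x hx => contK1 m hx)
      (continuousOn_const.mul (contW m)) hx
    rwa [integral_const_mul, intW m p μ hμ hx, mul_zero] at this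
  have h2 : ∫ s in S m, K2 m R (s 0) ∂μ = ∫ s in S m, K2 m 0 (s 0) ∂μ := by
    refine const_of (fun R => ∫ s in S m, K2 m R (s 0) ∂μ) ?_ hR
    intro x hx
    have := param μ hS isOpen_Ioo (fun R s => K2 m R (s 0))
      (fun R s => - 2 * R ^ (m + 1) * W m R (s 0))
      (fun x hx s hs => dK2 m hx (coord_mem hs 0)) (fun x hx => contK2 m hx)
      (ContinuousOn.mul (Continuous.continuousOn (by fun_prop)) (contW m)) hx
    rwa [integral_const_mul, intW m p μ hμ hx, mul_zero] at this
  have h3 : ∀ t, K1 m 0 t = 2 := by intro t; simp [K1]; norm_num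
  have h4 : ∀ t, K2 m 0 t = 0 := by intro t; simp [K2]
  simp only [h3] at h1
  simp only [h4, integral_zero] at h2
  rw [setIntegral_const, smul_eq_mul] at h1
  have h5 : ∀ s : E m, (1 - R ^ 2) * (1 + R ^ 2 - 2 * R * s 0) ^ (-((m:ℝ) + 3) / 2) =
      (1 / 2) * K1 m R (s 0) - (1 / (2 * R ^ (m + 1))) * K2 m R (s 0) := by
    intro s
    have : R ^ (m + 1) ≠ 0 := by positivity
    rw [K1, K2]
    field_simp
    ring
  rw [← integral_const_mul]
  simp only [h5]
  rw [integral_sub, integral_const_mul, integral_const_mul, h1, h2]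
  · ring
  · exact ((contK1 m hR).integrableOn_compact hS).const_mul _
  · exact ((contK2 m hR).integrableOn_compact hS).const_mul _

lemma norm_pow_eq (m : ℕ) (R : ℝ) (s : E m) (hs : s ∈ S m) (i : Fin (m + 3)) (hi : i = 0) :
    ‖s - R • EuclideanSpace.single i (1 : ℝ)‖ ^ (-((m + 3 : ℕ) : ℝ)) =
      (1 + R ^ 2 - 2 * R * s 0) ^ (-((m:ℝ) + 3) / 2) := by
  subst hi
  have hn : ‖s‖ = 1 := mem_sphere_zero_iff_norm.1 hs
  have h : ‖s - R • EuclideanSpace.single (0 : Fin (m + 3)) (1 : ℝ)‖ ^ 2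
      = 1 + R ^ 2 - 2 * R * s 0 := by
    rw [norm_sub_sq_real, hn, inner_smul_right, EuclideanSpace.inner_single_right, norm_smul]
    simp
    ring
  rw [← h, ← rpow_natCast, ← rpow_mul (norm_nonneg _)]
  congr 1
  push_cast
  ring

end SphAvg

/-- For `d ≥ 3` and `0 < R < 1`, the average of `|s - R e₁|^{-d}` over the unit sphere
`S^{d-1}` in `ℝ^d` equals `1/(1-R²)`. -/
theorem sphere_average_inv_dist_pow_of_lt_one
    (d : ℕ) (hd : 3 ≤ d) (R : ℝ) (hR0 : 0 < R) (hR1 : R < 1) :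
    (1 / (μH[(d : ℝ) - 1] (Metric.sphere (0 : EuclideanSpace ℝ (Fin d)) 1)).toReal) *
      ∫ s in Metric.sphere (0 : EuclideanSpace ℝ (Fin d)) 1,
        ‖s - R • EuclideanSpace.single (⟨0, by omega⟩ : Fin d) (1 : ℝ)‖ ^ (-(d : ℝ))
        ∂(μH[(d : ℝ) - 1])
    = 1 / (1 - R ^ 2) := by
  obtain ⟨m, rfl⟩ : ∃ m, d = m + 3 := ⟨d - 3, by omega⟩
  have hdim : ((m + 3 : ℕ) : ℝ) - 1 = (m : ℝ) + 2 := by push_cast; ring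
  rw [hdim]
  have hfin := SphAvg.fin m
  have hpos := SphAvg.pos m
  have hS : MeasurableSet (SphAvg.S m) := (isCompact_sphere _ _).measurableSet
  have : IsFiniteMeasure ((μH[(m : ℝ) + 2] : Measure (SphAvg.E m)).restrict (SphAvg.S m)) :=
    ⟨by rw [Measure.restrict_apply_univ]; exact hfin.lt_top⟩
  have hmain := SphAvg.main m ((m : ℝ) + 2)
    ((μH[(m : ℝ) + 2] : Measure (SphAvg.E m)).restrict (SphAvg.S m))
    (by rw [Measure.restrict_restrict hS, Set.inter_self]) hR0 hR1
  rw [Measure.restrict_restrict hS, Set.inter_self, Measure.real, Measure.restrict_apply hS,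
    Set.inter_self] at hmain
  rw [setIntegral_congr_fun hS (fun s hs => SphAvg.norm_pow_eq m R s hs ⟨0, by omega⟩ rfl)]
  have hne : (μH[(m : ℝ) + 2] (SphAvg.S m)).toReal ≠ 0 := ENNReal.toReal_ne_zero.2 ⟨hpos, hfin⟩
  have hq : 1 - R ^ 2 ≠ 0 := by nlinarith
  rw [← hmain] at hne ⊢
  have hJ := right_ne_zero_of_mul hne
  generalize (∫ s in SphAvg.S m, (1 + R ^ 2 - 2 * R * s 0) ^ (-((m:ℝ) + 3) / 2)
    ∂(μH[(m : ℝ) + 2])) = J at hJ ⊢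
  field_simp
end

section
/- For every R > 0, the integral over the plane ℝ² of -log|(R,0) - t| / (π(1+|t|²)²) with respect to Lebesgue measure dt equals (1/2) log(1/(1+R²)). Equivalently, the logarithmic potential of the measure with density |y₃|²/(π|x - y|⁴) on ℝ² (where y = (0,0,1)) coincides at each point x ∈ ℝ² with log(1/|x - y|), the logarithmic potential of the Dirac mass at y = (0,0,1). -/
open MeasureTheory Real

lemma aux_circ (R r : ℝ) :
    CircleIntegrable (fun z : ℂ => Real.log ‖z - (R : ℂ)‖) 0 r :=
  MeromorphicOn.circleIntegrable_log_norm (f := fun z : ℂ => z - (R : ℂ)) (fun _ _ ↦ by fun_prop)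

lemma aux_ang_int (R r : ℝ) :
    IntegrableOn (fun θ => Real.log ‖circleMap 0 r θ - (R : ℂ)‖) (Set.Ioo (-π) π) := by
  have h := aux_circ R r
  unfold CircleIntegrable at h
  have hp : Function.Periodic (fun θ => Real.log ‖circleMap 0 r θ - (R : ℂ)‖) (2 * π) := by
    intro θ
    simp only [periodic_circleMap 0 r θ]
  have h2 := hp.intervalIntegrable₀ (by positivity) h (-π) π
  rw [intervalIntegrable_iff_integrableOn_Ioo_of_le (by linarith [pi_pos])] at h2
  exact h2

lemma aux_ang (R r : ℝ) (hR : 0 < R) (hr : 0 < r) :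
    ∫ θ in Set.Ioo (-π) π, Real.log ‖circleMap 0 r θ - (R : ℂ)‖
      = 2 * π * Real.log (max r R) := by
  have h := circleAverage_log_norm_sub_const_eq_log_radius_add_posLog
    (a := (R : ℂ)) (c := 0) (R := r) hr.ne'
  have h3 : Real.log r + log⁺ (r⁻¹ * ‖(0 : ℂ) - R‖) = Real.log (max r R) := by
    simp only [zero_sub, norm_neg, Complex.norm_real, Real.norm_eq_abs, abs_of_pos hR]
    rcases le_total r R with hh | hh
    · rw [max_eq_right hh, posLog_eq_log, log_mul (by positivity) (by positivity), log_inv]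
      · ring
      · rw [abs_of_pos (by positivity)]
        rw [inv_mul_eq_div, one_le_div hr]; exact hh
    · rw [max_eq_left hh, (posLog_eq_zero_iff _).2, add_zero]
      rw [abs_of_pos (by positivity), inv_mul_eq_div, div_le_one hr]; exact hh
  rw [h3, circleAverage_eq_integral_add (-π), intervalIntegral.integral_comp_add_right
    (fun θ => Real.log ‖circleMap 0 r θ - (R : ℂ)‖), zero_add,
    show 2 * π + -π = π by ring, intervalIntegral.integral_of_le (by linarith [pi_pos]),
    integral_Ioc_eq_integral_Ioo, smul_eq_mul] at h
  rw [← h]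
  have := pi_pos
  field_simp

lemma aux_B (h : ℝ → ℝ) (hm : Measurable h) (A : ℝ) (hA : 0 ≤ A)
    (hb : ∀ r, 0 < r → |h r| ≤ A + r) :
    IntegrableOn (fun r => r / (1 + r ^ 2) ^ 2 * h r) (Set.Ioi 0) := by
  refine Integrable.mono' ((integrable_inv_one_add_sq.const_mul (A + 1)).integrableOn)
    (by fun_prop) ?_
  filter_upwards [ae_restrict_mem measurableSet_Ioi] with r hr
  have hr : 0 < r := hr
  rw [norm_mul, Real.norm_eq_abs, Real.norm_eq_abs, abs_of_pos (by positivity)]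
  calc r / (1 + r ^ 2) ^ 2 * |h r| ≤ r / (1 + r ^ 2) ^ 2 * (A + r) := by
        gcongr; exact hb r hr
    _ ≤ _ := by
        rw [div_mul_eq_mul_div, ← div_eq_mul_inv, div_le_div_iff₀ (by positivity) (by positivity)]
        have : r * (A + r) ≤ (A + 1) * (1 + r ^ 2) := by
          nlinarith [mul_nonneg hA (sq_nonneg (r - 1)), mul_nonneg hA (sq_nonneg r)]
        nlinarith [sq_nonneg r]

lemma aux_max_bd (R r : ℝ) (hR : 0 < R) (hr : 0 < r) :
    |Real.log (max r R)| ≤ |Real.log R| + r := by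
  rw [abs_le]
  constructor
  · have := Real.log_le_log hR (le_max_right r R)
    linarith [neg_abs_le (Real.log R)]
  · rcases le_total r R with hh | hh
    · rw [max_eq_right hh]; linarith [le_abs_self (Real.log R)]
    · rw [max_eq_left hh]; linarith [abs_nonneg (Real.log R), Real.log_le_sub_one_of_pos hr]

lemma aux_C (R : ℝ) (hR : 0 < R) :
    ∫ r in Set.Ioi 0, r / (1 + r ^ 2) ^ 2 * Real.log (max r R) = 1 / 4 * Real.log (1 + R ^ 2) := by
  have hint := aux_B (fun r => Real.log (max r R)) (by fun_prop) |Real.log R| (abs_nonneg _)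
    (fun r hr => aux_max_bd R r hR hr)
  rw [← Set.Ioc_union_Ioi_eq_Ioi hR.le] at hint ⊢
  rw [setIntegral_union (Set.Ioc_disjoint_Ioi le_rfl) measurableSet_Ioi hint.left_of_union
    hint.right_of_union]
  have h1 : ∫ r in Set.Ioc 0 R, r / (1 + r ^ 2) ^ 2 * Real.log (max r R)
      = R ^ 2 / (2 * (1 + R ^ 2)) * Real.log R := by
    rw [setIntegral_congr_fun (g := fun r => r / (1 + r ^ 2) ^ 2 * Real.log R) measurableSet_Ioc
      (fun r hr => by simp only [max_eq_right hr.2]),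
      integral_mul_const, ← intervalIntegral.integral_of_le hR.le,
      intervalIntegral.integral_eq_sub_of_hasDerivAt (f := fun r => -(1 / 2) * (1 + r ^ 2)⁻¹)]
    · congr 1
      field_simp
      ring
    · intro x _
      have : HasDerivAt (fun r : ℝ => 1 + r ^ 2) (2 * x) x := by
        simpa using (hasDerivAt_pow 2 x).const_add 1
      have := (this.inv (by positivity)).const_mul (-(1 / 2))
      refine HasDerivAt.congr_deriv this ?_
      field_simp
    · apply Continuous.intervalIntegrable
      fun_prop (disch := intro x; positivity)
  have h2 : ∫ r in Set.Ioi R, r / (1 + r ^ 2) ^ 2 * Real.log (max r R)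
      = 0 - (1 / 2) * (R ^ 2 / (1 + R ^ 2) * Real.log R - 1 / 2 * Real.log (1 + R ^ 2)) := by
    have hcongr : Set.EqOn (fun r => r / (1 + r ^ 2) ^ 2 * Real.log (max r R))
        (fun r => r / (1 + r ^ 2) ^ 2 * Real.log r) (Set.Ioi R) := fun r hr => by
      simp only [max_eq_left (le_of_lt (show R < r from hr))]
    have hi2 := (integrableOn_congr_fun hcongr measurableSet_Ioi).1 hint.right_of_union
    rw [setIntegral_congr_fun measurableSet_Ioi hcongr]
    refine integral_Ioi_of_hasDerivAt_of_tendsto'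
      (f := fun r => (1 / 2) * (r ^ 2 / (1 + r ^ 2) * Real.log r - 1 / 2 * Real.log (1 + r ^ 2)))
      ?_ hi2 ?_
    · intro x hx
      have hx0 : 0 < x := lt_of_lt_of_le hR hx
      have d1 : HasDerivAt (fun r : ℝ => 1 + r ^ 2) (2 * x) x := by
        simpa using (hasDerivAt_pow 2 x).const_add 1
      have d0 : HasDerivAt (fun r : ℝ => r ^ 2) (2 * x) x := by
        simpa using (hasDerivAt_pow 2 x)
      have := (((d0.div d1 (by positivity)).mul (Real.hasDerivAt_log hx0.ne')).sub
        ((d1.log (by positivity)).const_mul (1 / 2))).const_mul (1 / 2)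
      refine HasDerivAt.congr_deriv this ?_
      simp only [Pi.div_apply]
      field_simp
      ring
    · have t1 : Filter.Tendsto (fun r : ℝ => Real.log r / r) Filter.atTop (nhds 0) :=
        Real.isLittleO_log_id_atTop.tendsto_div_nhds_zero
      have t2 : Filter.Tendsto (fun r : ℝ => Real.log r / (1 + r ^ 2)) Filter.atTop (nhds 0) := by
        refine squeeze_zero' ?_ ?_ t1
        · filter_upwards [Filter.eventually_ge_atTop 1] with r hr
          have := Real.log_nonneg hr
          positivity
        · filter_upwards [Filter.eventually_ge_atTop 1] with r hr
          have := Real.log_nonneg hr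
          gcongr
          nlinarith
      have t3 : Filter.Tendsto (fun r : ℝ => Real.log (r ^ (-2 : ℤ) + 1)) Filter.atTop (nhds 0) := by
        have := (tendsto_zpow_atTop_zero (𝕜 := ℝ) (n := -2) (by norm_num)).add_const 1
        rw [zero_add] at this
        have := this.log (by norm_num)
        simpa using this
      have t4 := ((t2.neg.sub (t3.const_mul (1 / 2))).const_mul (1 / 2))
      simp only [neg_zero, mul_zero, sub_zero] at t4
      refine t4.congr' ?_
      filter_upwards [Filter.eventually_gt_atTop 0] with r hr
      have e : r ^ (-2 : ℤ) + 1 = (1 + r ^ 2) / r ^ 2 := by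
        rw [zpow_neg]; norm_cast; field_simp
      rw [e, Real.log_div (by positivity) (by positivity), Real.log_pow]
      field_simp
      push_cast
      ring
  rw [h1, h2]
  field_simp
  ring

lemma aux_int (R : ℝ) (hR : 0 < R) :
    Integrable (fun p : ℝ × ℝ => p.1 / (1 + p.1 ^ 2) ^ 2 *
      Real.log ‖circleMap 0 p.1 p.2 - (R : ℂ)‖)
      ((volume.restrict (Set.Ioi 0)).prod (volume.restrict (Set.Ioo (-π) π))) := by
  have hmeas : Measurable (fun p : ℝ × ℝ => Real.log ‖circleMap 0 p.1 p.2 - (R : ℂ)‖) := by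
    unfold circleMap
    fun_prop
  have hlog : ∀ r, 0 < r → ∀ θ,
      |Real.log ‖circleMap 0 r θ - (R : ℂ)‖| ≤
        2 * Real.log (1 + r + R) - Real.log ‖circleMap 0 r θ - (R : ℂ)‖ := by
    intro r hr θ
    have hL : 0 ≤ Real.log (1 + r + R) := Real.log_nonneg (by linarith)
    have : Real.log ‖circleMap 0 r θ - (R : ℂ)‖ ≤ Real.log (1 + r + R) := by
      rcases eq_or_lt_of_le (norm_nonneg (circleMap 0 r θ - (R : ℂ))) with h0 | h0
      · rw [← h0]; simpa using hL
      · apply Real.log_le_log h0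
        refine (norm_sub_le _ _).trans ?_
        rw [norm_circleMap_zero, Complex.norm_real, Real.norm_eq_abs, abs_of_pos hr, abs_of_pos hR]
        linarith
    rw [abs_le]; constructor <;> linarith
  rw [integrable_prod_iff (by fun_prop)]
  constructor
  · exact Filter.Eventually.of_forall fun r =>
      (aux_ang_int R r).const_mul (r / (1 + r ^ 2) ^ 2)
  · have b1 := aux_B (fun r => Real.log (1 + r + R)) (by fun_prop) R hR.le (fun r hr => by
      rw [abs_of_nonneg (Real.log_nonneg (by linarith))]
      linarith [Real.log_le_sub_one_of_pos (show 0 < 1 + r + R by linarith)])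
    have b2 := aux_B (fun r => Real.log (max r R)) (by fun_prop) |Real.log R| (abs_nonneg _)
      (fun r hr => aux_max_bd R r hR hr)
    refine Integrable.mono' ((b1.const_mul (4 * π)).sub (b2.const_mul (2 * π))) ?_ ?_
    · apply AEStronglyMeasurable.integral_prod_right'
        (f := fun p : ℝ × ℝ => ‖p.1 / (1 + p.1 ^ 2) ^ 2 *
          Real.log ‖circleMap 0 p.1 p.2 - (R : ℂ)‖‖)
      fun_prop
    · filter_upwards [ae_restrict_mem measurableSet_Ioi] with r hr
      have hr : 0 < r := hr
      rw [Real.norm_eq_abs, abs_of_nonneg (integral_nonneg fun _ => norm_nonneg _)]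
      simp only [norm_mul]
      rw [integral_const_mul, Real.norm_eq_abs, abs_of_pos (by positivity)]
      have hc : IntegrableOn (fun _ : ℝ => 2 * Real.log (1 + r + R)) (Set.Ioo (-π) π) := by
        exact integrableOn_const (by simp)
      have : ∫ θ in Set.Ioo (-π) π, ‖Real.log ‖circleMap 0 r θ - (R : ℂ)‖‖ ≤
          4 * π * Real.log (1 + r + R) - 2 * π * Real.log (max r R) := by
        calc _ ≤ ∫ θ in Set.Ioo (-π) π, (2 * Real.log (1 + r + R) -
              Real.log ‖circleMap 0 r θ - (R : ℂ)‖) :=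
              integral_mono (aux_ang_int R r).norm (hc.sub (aux_ang_int R r)) (hlog r hr)
          _ = _ := by
              rw [integral_sub hc (aux_ang_int R r), aux_ang R r hR hr]
              simp [pi_pos.le]
              ring
      calc _ ≤ r / (1 + r ^ 2) ^ 2 *
            (4 * π * Real.log (1 + r + R) - 2 * π * Real.log (max r R)) := by gcongr
        _ = _ := by simp only [Pi.sub_apply]; ring

/-- The logarithmic potential of the balayage density `1/(π(1+|t|²)²)` on the plane,
evaluated at `(R,0)`, equals `(1/2) log(1/(1+R²))`. -/
theorem log_potential_balayage_density (R : ℝ) (hR : 0 < R) :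
    (∫ t : EuclideanSpace ℝ (Fin 2),
        -Real.log ‖R • EuclideanSpace.single (0 : Fin 2) (1 : ℝ) - t‖ /
          (Real.pi * (1 + ‖t‖ ^ 2) ^ 2))
    = (1 / 2) * Real.log (1 / (1 + R ^ 2)) := by
  have e := Complex.orthonormalBasisOneI.measurePreserving_repr.integral_comp
    Complex.orthonormalBasisOneI.repr.toHomeomorph.measurableEmbedding
    (fun t : EuclideanSpace ℝ (Fin 2) =>
      -Real.log ‖R • EuclideanSpace.single (0 : Fin 2) (1 : ℝ) - t‖ /
          (Real.pi * (1 + ‖t‖ ^ 2) ^ 2))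
  rw [← e]
  have hs : R • EuclideanSpace.single (0 : Fin 2) (1 : ℝ)
      = Complex.orthonormalBasisOneI.repr (R : ℂ) := by
    ext i
    fin_cases i <;> simp
  simp only [hs, ← map_sub, LinearIsometryEquiv.norm_map]
  rw [← Complex.integral_comp_polarCoord_symm]
  have hI : ∫ p in polarCoord.target, p.1 / (1 + p.1 ^ 2) ^ 2 *
      Real.log ‖circleMap 0 p.1 p.2 - (R : ℂ)‖ = 2 * π * (1 / 4 * Real.log (1 + R ^ 2)) := by
    rw [polarCoord_target, Measure.volume_eq_prod, ← Measure.prod_restrict,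
      integral_prod _ (aux_int R hR), ← aux_C R hR, ← integral_const_mul]
    apply setIntegral_congr_fun measurableSet_Ioi
    intro r hr
    simp only
    rw [integral_const_mul, aux_ang R r hR hr]
    ring
  have hcongr : ∀ p : ℝ × ℝ, p.1 • (-Real.log ‖(R : ℂ) - Complex.polarCoord.symm p‖ /
      (π * (1 + ‖Complex.polarCoord.symm p‖ ^ 2) ^ 2)) = -(1 / π) * (p.1 / (1 + p.1 ^ 2) ^ 2 *
      Real.log ‖circleMap 0 p.1 p.2 - (R : ℂ)‖) := by
    intro p
    have : Complex.polarCoord.symm p = circleMap 0 p.1 p.2 := by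
      simp [circleMap, Complex.exp_mul_I]
    rw [Complex.norm_polarCoord_symm, sq_abs, this, norm_sub_rev, smul_eq_mul]
    have := pi_pos
    field_simp
  simp only [hcongr]
  rw [integral_const_mul, hI, one_div (1 + R ^ 2), Real.log_inv]
  have := pi_pos
  field_simp
  ring
end
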